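/- For q = p^t ≡ 1 (mod 4), the number of p-adic elementary divisors of the Laplacian of the Paley graph P(q) equal to p^λ for 0 ≤ λ < t is f(t,λ) = Σ_{i=0}^{min(λ,t−λ)} (t/(t−i))·C(t−i,i)·C(t−2i,λ−i)·(−p)^i·((p+1)/2)^{t−2i}, and the number equal to p^t is ((p+1)/2)^t − 2. -/

import Mathlib

/-! ### Digit sums -/

namespace PaleySmith

/-- The sum of the base-`p` digits of `n`. -/
def digitSum (p n : ℕ) : ℕ := (Nat.digits p n).sum

/-- The number with `t` base-`p` digits, all equal to `h`. -/
def repdigit (p h : ℕ) : ℕ → ℕ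
  | 0 => 0
  | t + 1 => p * repdigit p h t + h

/-- The sum of the carries when adding `repdigit p h t` and the incoming carry `ε` to `a`. -/
def carrySum (p h : ℕ) : ℕ → ℕ → ℕ → ℕ
  | _, 0, _ => 0
  | ε, t + 1, a => (a % p + h + ε) / p + carrySum p h ((a % p + h + ε) / p) t (a / p)

section digitSum

variable {p : ℕ}

@[simp] lemma digitSum_zero : digitSum p 0 = 0 := by simp [digitSum]

lemma digitSum_of_lt {b : ℕ} (hb : b < p) : digitSum p b = b := by
  rcases Nat.eq_zero_or_pos b with rfl | h
  · simp
  · simp [digitSum, Nat.digits_of_lt p b h.ne' hb]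

lemma digitSum_mul_add (hp : 1 < p) (a : ℕ) {b : ℕ} (hb : b < p) :
    digitSum p (p * a + b) = digitSum p a + b := by
  rcases Nat.eq_zero_or_pos (p * a + b) with h | h
  · have hb0 : b = 0 := by omega
    have ha0 : a = 0 := by
      rcases Nat.mul_eq_zero.1 (show p * a = 0 by omega) with h' | h' <;> omega
    simp [ha0, hb0]
  · unfold digitSum
    rw [Nat.digits_def' hp h, List.sum_cons, Nat.mul_add_mod, Nat.mod_eq_of_lt hb,
      Nat.mul_add_div (by omega), Nat.div_eq_of_lt hb, add_zero, add_comm]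

lemma digitSum_div_mod (hp : 1 < p) (n : ℕ) :
    digitSum p n = digitSum p (n / p) + n % p := by
  conv_lhs => rw [← Nat.div_add_mod n p]
  exact digitSum_mul_add hp _ (Nat.mod_lt _ (by omega))

lemma digitSum_pow_mul_add (hp : 1 < p) (t : ℕ) :
    ∀ (a : ℕ) {b : ℕ}, b < p ^ t → digitSum p (p ^ t * a + b) = digitSum p a + digitSum p b := by
  induction t with
  | zero => intro a b hb; simp at hb; simp [hb]
  | succ t ih =>
    intro a b hb
    have h1 : p ^ (t + 1) * a + b = p * (p ^ t * a + b / p) + b % p := by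
      conv_lhs => rw [← Nat.div_add_mod b p]
      ring
    have h2 : b / p < p ^ t := by
      apply Nat.div_lt_of_lt_mul
      rwa [← pow_succ']
    rw [h1, digitSum_mul_add hp _ (Nat.mod_lt _ (by omega)), ih a h2, digitSum_div_mod hp b]
    ring

lemma digitSum_pow_mul (hp : 1 < p) (t a : ℕ) : digitSum p (p ^ t * a) = digitSum p a := by
  simpa using digitSum_pow_mul_add hp t a (b := 0) (by positivity)

lemma digitSum_add_complement (hp : 1 < p) (t : ℕ) :
    ∀ {a b : ℕ}, a + b + 1 = p ^ t → digitSum p a + digitSum p b = t * (p - 1) := by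
  induction t with
  | zero =>
    intro a b h
    have : a = 0 ∧ b = 0 := by simp at h; omega
    simp [this.1, this.2]
  | succ t ih =>
    intro a b h
    have ha := Nat.div_add_mod a p
    have hb := Nat.div_add_mod b p
    have ha' := Nat.mod_lt a (show p > 0 by omega)
    have hb' := Nat.mod_lt b (show p > 0 by omega)
    rw [pow_succ'] at h
    have key : p * (a / p + b / p) + (a % p + b % p + 1) = p * p ^ t := by
      rw [← h, mul_add]; omega
    have hd : p ∣ a % p + b % p + 1 := by
      have h1 : p ∣ p * (a / p + b / p) + (a % p + b % p + 1) := key ▸ dvd_mul_right _ _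
      exact (Nat.dvd_add_right (dvd_mul_right _ _)).1 h1
    have hm : a % p + b % p + 1 = p := by
      obtain ⟨c, hc⟩ := hd
      have : c = 1 := by
        have h2 : c < 2 := by
          by_contra hcon
          have : p * 2 ≤ p * c := Nat.mul_le_mul_left _ (by omega)
          omega
        interval_cases c <;> omega
      rw [hc, this, mul_one]
    have hs : a / p + b / p + 1 = p ^ t := by
      rw [hm] at key
      apply Nat.eq_of_mul_eq_mul_left (show 0 < p by omega)
      rw [← key]; ring
    rw [digitSum_div_mod hp a, digitSum_div_mod hp b, add_mul, ← ih hs]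
    omega

lemma digitSum_add_le (hp : p.Prime) (a b : ℕ) :
    digitSum p (a + b) ≤ digitSum p a + digitSum p b := by
  have : Fact p.Prime := ⟨hp⟩
  have h1 := sub_one_mul_padicValNat_factorial (p := p) a
  have h2 := sub_one_mul_padicValNat_factorial (p := p) b
  have h3 := sub_one_mul_padicValNat_factorial (p := p) (a + b)
  have h4 : padicValNat p (a.factorial) + padicValNat p (b.factorial) ≤
      padicValNat p ((a + b).factorial) := by
    rw [← padicValNat.mul (Nat.factorial_ne_zero _) (Nat.factorial_ne_zero _)]
    exact (padicValNat_dvd_iff_le (Nat.factorial_ne_zero _)).1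
      (pow_padicValNat_dvd.trans (Nat.factorial_mul_factorial_dvd_factorial_add a b))
  have h5 := Nat.mul_le_mul_left (p - 1) h4
  rw [mul_add, h1, h2, h3] at h5
  have ha := Nat.digit_sum_le p a
  have hb := Nat.digit_sum_le p b
  have hab := Nat.digit_sum_le p (a + b)
  unfold digitSum
  omega

lemma digitSum_mod_le (hp : p.Prime) (t : ℕ) (m : ℕ) :
    digitSum p (m % (p ^ t - 1)) ≤ digitSum p m := by
  induction m using Nat.strong_induction_on with
  | _ m ih =>
    rcases Nat.lt_or_ge m (p ^ t - 1) with h | h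
    · rw [Nat.mod_eq_of_lt h]
    rcases Nat.lt_or_ge 1 (p ^ t) with h1 | h1
    · rcases h.eq_or_lt with h | h
      · simp [← h]
      have hdm := Nat.div_add_mod m (p ^ t)
      have hpos : 0 < m / p ^ t := Nat.div_pos (by omega) (by omega)
      have hdec : m = (m / p ^ t + m % p ^ t) + (p ^ t - 1) * (m / p ^ t) := by
        conv_lhs => rw [← hdm]
        rw [Nat.sub_mul, one_mul]
        have : m / p ^ t ≤ p ^ t * (m / p ^ t) := Nat.le_mul_of_pos_left _ (by omega)
        omega
      have hlt : m / p ^ t + m % p ^ t < m := by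
        have : 0 < (p ^ t - 1) * (m / p ^ t) := Nat.mul_pos (by omega) hpos
        omega
      have hmod : m % (p ^ t - 1) = (m / p ^ t + m % p ^ t) % (p ^ t - 1) := by
        conv_lhs => rw [hdec]
        rw [Nat.add_mul_mod_self_left]
      rw [hmod]
      refine (ih _ hlt).trans ((digitSum_add_le hp _ _).trans ?_)
      conv_rhs => rw [← hdm]
      rw [digitSum_pow_mul_add hp.one_lt t _ (Nat.mod_lt _ (by omega))]
    · rw [show p ^ t - 1 = 0 by omega, Nat.mod_zero]

end digitSum

section carries

variable {p h : ℕ}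

lemma two_mul_repdigit (hph : p = 2 * h + 1) (t : ℕ) : 2 * repdigit p h t + 1 = p ^ t := by
  induction t with
  | zero => simp [repdigit]
  | succ t ih =>
    rw [repdigit, pow_succ', ← ih]
    generalize repdigit p h t = r
    rw [hph]; ring

lemma digitSum_repdigit (hp : 1 < p) (hh : h < p) (t : ℕ) :
    digitSum p (repdigit p h t) = t * h := by
  induction t with
  | zero => simp [repdigit]
  | succ t ih => rw [repdigit, digitSum_mul_add hp _ hh, ih]; ring

lemma carry_le_one (hph : p = 2 * h + 1) (hh : 0 < h) (a : ℕ) {ε : ℕ} (hε : ε ≤ 1) :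
    (a % p + h + ε) / p ≤ 1 := by
  have := Nat.mod_lt a (show p > 0 by omega)
  exact Nat.le_of_lt_succ (Nat.div_lt_of_lt_mul (by omega))

lemma add_repdigit_succ (p h t a ε : ℕ) :
    a + repdigit p h (t + 1) + ε = p * (a / p + repdigit p h t) + (a % p + h + ε) := by
  conv_lhs => rw [← Nat.div_add_mod a p]
  rw [repdigit]; ring

lemma add_repdigit_div (hp : 0 < p) (t a ε : ℕ) :
    (a + repdigit p h (t + 1) + ε) / p = a / p + repdigit p h t + (a % p + h + ε) / p := by
  rw [add_repdigit_succ, Nat.mul_add_div hp]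

lemma digitSum_add_carrySum (hph : p = 2 * h + 1) (hh : 0 < h) (t : ℕ) :
    ∀ {ε a : ℕ}, ε ≤ 1 → a < p ^ t →
      digitSum p a + t * h + ε =
        digitSum p (a + repdigit p h t + ε) + (p - 1) * carrySum p h ε t a := by
  induction t with
  | zero =>
    intro ε a hε ha
    have : a = 0 := by simpa using ha
    simp [this, repdigit, carrySum, digitSum_of_lt (show ε < p by omega)]
  | succ t ih =>
    intro ε a hε ha
    have h1 := ih (a := a / p) (carry_le_one hph hh a hε)
      (Nat.div_lt_of_lt_mul (by rwa [← pow_succ']))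
    rw [digitSum_div_mod (by omega) a, digitSum_div_mod (by omega) (a + _ + ε),
      add_repdigit_div (by omega), carrySum]
    have h2 : (a + repdigit p h (t + 1) + ε) % p = (a % p + h + ε) % p := by
      rw [add_repdigit_succ, Nat.mul_add_mod]
    have h3 := Nat.div_add_mod (a % p + h + ε) p
    rw [h2]
    generalize (a % p + h + ε) / p = γ at *
    generalize (a % p + h + ε) % p = r at *
    have h4 : p * γ = (p - 1) * γ + γ := by
      conv_lhs => rw [show p = p - 1 + 1 by omega]
      ring
    rw [mul_add]
    have h5 : (t + 1) * h = t * h + h := by ring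
    omega

end carries

end PaleySmith

/-! ### Lucas polynomials and cyclic carry counts -/

namespace PaleySmith

open Polynomial

/-- The coefficient `t / (t - i) * C(t - i, i)` of Waring's formula. -/
def waring (t i : ℕ) : ℚ := (t : ℚ) / ((t : ℚ) - (i : ℚ)) * ((t - i).choose i : ℚ)

lemma waring_zero {t : ℕ} (ht : 1 ≤ t) : waring t 0 = 1 := by
  have : (t : ℚ) ≠ 0 := by positivity
  simp [waring, this]

lemma waring_eq_zero {t i : ℕ} (ht : 1 ≤ t) (hi : t < 2 * i) : waring t i = 0 := by
  rw [waring, Nat.choose_eq_zero_of_lt (by omega)]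
  simp

lemma waring_succ {t : ℕ} (ht : 1 ≤ t) (i : ℕ) :
    waring (t + 2) (i + 1) = waring (t + 1) (i + 1) + waring t i := by
  rcases Nat.lt_or_ge t (2 * i) with h | h
  · rw [waring_eq_zero (by omega) (by omega), waring_eq_zero (by omega) (by omega),
      waring_eq_zero ht h, add_zero]
  obtain ⟨n, rfl⟩ := Nat.exists_eq_add_of_le (show i ≤ t by omega)
  have hn : 1 ≤ n := by omega
  have h1 : i + n + 2 - (i + 1) = n + 1 := by omega
  have h2 : i + n + 1 - (i + 1) = n := by omega
  have h3 : i + n - i = n := by omega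
  have c1 : ((n + 1).choose (i + 1) : ℚ) * (i + 1) = (n + 1) * n.choose i := by
    exact_mod_cast (Nat.add_one_mul_choose_eq n i).symm
  have c2 : (n.choose (i + 1) : ℚ) * (i + 1) = n.choose i * (n - i) := by
    have := Nat.choose_succ_right_eq n i
    rw [← Nat.cast_sub (by omega)]
    exact_mod_cast this
  have hi0 : (i + 1 : ℚ) ≠ 0 := by positivity
  have hn0 : (n : ℚ) ≠ 0 := by positivity
  have hn1 : (n + 1 : ℚ) ≠ 0 := by positivity
  rw [waring, waring, waring, h1, h2, h3, eq_div_of_mul_eq hi0 c1, eq_div_of_mul_eq hi0 c2]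
  push_cast
  rw [show (i + n + 2 - (i + 1) : ℚ) = n + 1 by ring, show (i + n + 1 - (i + 1) : ℚ) = n by ring,
    show (i + n - i : ℚ) = n by ring]
  field_simp
  ring

/-- Waring's formula for a sequence of Lucas type. -/
lemma lucas_eq_sum {A : Type*} [CommRing A] [Algebra ℚ A] (T D : A) (V : ℕ → A)
    (h1 : V 1 = T) (h2 : V 2 = T ^ 2 - 2 * D) (hV : ∀ t, V (t + 2) = T * V (t + 1) - D * V t)
    (t : ℕ) : V (t + 1) =
      ∑ i ∈ Finset.range (t + 2), algebraMap ℚ A (waring (t + 1) i) * (-D) ^ i *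
        T ^ (t + 1 - 2 * i) := by
  induction t using Nat.twoStepInduction with
  | zero =>
    simp [Finset.sum_range_succ, h1, waring_zero, waring_eq_zero (t := 1) (i := 1)]
  | one =>
    have : waring 2 1 = 2 := by norm_num [waring]
    simp [Finset.sum_range_succ, h2, waring_zero, waring_eq_zero (t := 2) (i := 2), this,
      map_ofNat]
    ring
  | more t ih1 ih2 =>
    have e1 : T * V (t + 2) = ∑ i ∈ Finset.range (t + 4),
        algebraMap ℚ A (waring (t + 2) i) * (-D) ^ i * T ^ (t + 3 - 2 * i) := by
      rw [Finset.sum_range_succ, waring_eq_zero (by omega) (by omega), ih2, Finset.mul_sum]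
      simp only [map_zero, zero_mul, add_zero]
      refine Finset.sum_congr rfl fun i _ => ?_
      rcases Nat.lt_or_ge (t + 2) (2 * i) with h | h
      · rw [waring_eq_zero (by omega) h]; simp
      · rw [show t + 3 - 2 * i = (t + 1 + 1 - 2 * i) + 1 by omega, pow_succ]; ring
    have e2 : D * V (t + 1) = -∑ i ∈ Finset.range (t + 3),
        algebraMap ℚ A (waring (t + 1) i) * (-D) ^ (i + 1) * T ^ (t + 3 - 2 * (i + 1)) := by
      rw [Finset.sum_range_succ, waring_eq_zero (by omega) (by omega), ih1, Finset.mul_sum,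
        map_zero, zero_mul, zero_mul, add_zero, ← Finset.sum_neg_distrib]
      refine Finset.sum_congr rfl fun i _ => ?_
      rw [show t + 3 - 2 * (i + 1) = t + 1 - 2 * i by omega]; ring
    rw [hV, e1, e2, Finset.sum_range_succ', Finset.sum_range_succ' _ (t + 3), sub_neg_eq_add,
      add_right_comm, ← Finset.sum_add_distrib]
    refine congr_arg₂ _ (Finset.sum_congr rfl fun i _ => ?_) ?_
    · rw [waring_succ (t := t + 1) (by omega), map_add]; ring
    · simp [waring_zero]

lemma sum_range_mul_eq {A : Type*} [AddCommMonoid A] (m n : ℕ) (f : ℕ → A) :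
    ∑ a ∈ Finset.range (m * n), f a =
      ∑ b ∈ Finset.range m, ∑ a ∈ Finset.range n, f (m * a + b) := by
  rw [mul_comm, Finset.sum_range, ← finProdFinEquiv.sum_comp, Fintype.sum_prod_type,
    Finset.sum_comm, Finset.sum_range]
  refine Finset.sum_congr rfl fun b _ => ?_
  rw [Finset.sum_range]
  exact Finset.sum_congr rfl fun a _ => by simp [finProdFinEquiv, add_comm]

/-- The generating function of `carrySum`, by incoming and outgoing carry. -/
noncomputable def carryGF (p h t : ℕ) : Matrix (Fin 2) (Fin 2) ℚ[X] :=
  Matrix.of fun ε δ => ∑ a ∈ Finset.range (p ^ t),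
    if (a + repdigit p h t + ε) / p ^ t = δ then X ^ carrySum p h ε t a else 0

/-- The transfer matrix of carry propagation. -/
noncomputable def carryTransfer (h : ℕ) : Matrix (Fin 2) (Fin 2) ℚ[X] :=
  !![(h : ℚ[X]) + 1, (h : ℚ[X]) * X; (h : ℚ[X]), ((h : ℚ[X]) + 1) * X]

lemma sum_carry {p h : ℕ} (hph : p = 2 * h + 1) (hh : 0 < h) (ε : Fin 2) (g : ℕ → ℚ[X]) :
    ∑ b ∈ Finset.range p, g ((b + h + ε) / p) =
      (h + 1 - (ε : ℕ)) * g 0 + (h + (ε : ℕ)) * g 1 := by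
  have hε := ε.isLt
  rw [show p = (h + 1 - ε) + (h + ε) by omega, Finset.sum_range_add]
  rw [show (h + 1 - ε) + (h + ε) = p by omega]
  rw [Finset.sum_congr (g := fun _ => g 0) rfl,
    Finset.sum_congr (g := fun _ => g 1) (s₂ := Finset.range (h + ε)) rfl]
  · simp [Nat.cast_sub (show (ε : ℕ) ≤ h + 1 by omega)]
  · intro b hb
    rw [Finset.mem_range] at hb
    congr 1
    exact Nat.div_eq_of_lt_le (by omega) (by omega)
  · intro b hb
    rw [Finset.mem_range] at hb
    rw [Nat.div_eq_of_lt (by omega)]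

lemma carryGF_eq_pow {p h : ℕ} (hph : p = 2 * h + 1) (hh : 0 < h) (t : ℕ) :
    carryGF p h t = carryTransfer h ^ t := by
  induction t with
  | zero =>
    ext1 ε δ
    fin_cases ε <;> fin_cases δ <;> simp [carryGF, repdigit, carrySum] <;> rfl
  | succ t ih =>
    rw [pow_succ', ← ih]
    ext1 ε δ
    let g : ℕ → ℚ[X] := fun γ => ∑ a ∈ Finset.range (p ^ t),
      if (a + repdigit p h t + γ) / p ^ t = δ then X ^ (γ + carrySum p h γ t a) else 0
    have hg : carryGF p h (t + 1) ε δ = ∑ b ∈ Finset.range p, g ((b + h + ε) / p) := by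
      simp only [carryGF, Matrix.of_apply, g]
      rw [pow_succ', sum_range_mul_eq]
      refine Finset.sum_congr rfl fun b hb => Finset.sum_congr rfl fun a _ => ?_
      rw [Finset.mem_range] at hb
      have hm : (p * a + b) % p = b := by rw [Nat.mul_add_mod, Nat.mod_eq_of_lt hb]
      have hd : (p * a + b) / p = a := by
        rw [Nat.mul_add_div (by omega), Nat.div_eq_of_lt hb, add_zero]
      rw [← Nat.div_div_eq_div_mul, add_repdigit_div (by omega), carrySum, hm, hd]
    have hgε : ∀ γ : Fin 2, g γ = X ^ (γ : ℕ) * carryGF p h t γ δ := by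
      intro γ
      simp only [carryGF, Matrix.of_apply, g, Finset.mul_sum, mul_ite, mul_zero, pow_add]
    have hg0 := hgε 0
    have hg1 := hgε 1
    simp only [Fin.val_zero, Fin.val_one, pow_zero, pow_one, one_mul] at hg0 hg1
    rw [hg, sum_carry hph hh, hg0, hg1, Matrix.mul_apply, Fin.sum_univ_two]
    fin_cases ε <;> simp [carryTransfer] <;> ring

lemma trace_carryTransfer_pow {p h : ℕ} (hph : p = 2 * h + 1) {t : ℕ} (ht : 1 ≤ t) :
    (carryTransfer h ^ t).trace = ∑ i ∈ Finset.range (t + 1),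
      C (waring t i * (-(p : ℚ)) ^ i * (h + 1) ^ (t - 2 * i)) * (X ^ i * (1 + X) ^ (t - 2 * i)) := by
  obtain ⟨t, rfl⟩ := Nat.exists_eq_add_of_le' ht
  have hCH : carryTransfer h * carryTransfer h =
      (((h : ℚ[X]) + 1) * (1 + X)) • carryTransfer h - ((p : ℚ[X]) * X) • 1 := by
    ext1 i j
    fin_cases i <;> fin_cases j <;>
      simp [carryTransfer, hph] <;> ring
  have htr : (carryTransfer h).trace = ((h : ℚ[X]) + 1) * (1 + X) := by
    simp [carryTransfer, Matrix.trace_fin_two]; ring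
  rw [lucas_eq_sum (((h : ℚ[X]) + 1) * (1 + X)) ((p : ℚ[X]) * X)
    (fun t => (carryTransfer h ^ t).trace)]
  · refine Finset.sum_congr rfl fun i _ => ?_
    rw [Polynomial.algebraMap_eq]
    simp only [C_mul, C_pow, C_neg, C_add, C_1, map_natCast]
    rw [← neg_mul, mul_pow, mul_pow]
    ring
  · simp [htr]
  · rw [pow_two, hCH, Matrix.trace_sub, Matrix.trace_smul, Matrix.trace_smul, htr]
    simp; ring
  · intro t
    rw [pow_add, pow_two, hCH, mul_sub, Matrix.trace_sub, mul_smul_comm, mul_smul_comm,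
      Matrix.trace_smul, Matrix.trace_smul, ← pow_succ]
    simp

/-- The number of carries when adding `repdigit p h t` to `a` modulo `p ^ t - 1`. -/
def cyclicCarry (p h t a : ℕ) : ℕ :=
  carrySum p h (if a ≤ repdigit p h t then 0 else 1) t a

/-- The number of residues `a` modulo `p ^ t - 1` with `cyclicCarry p h t a = l`. -/
def carryCount (p h t l : ℕ) : ℕ :=
  ((Finset.range (2 * repdigit p h t)).filter fun a => cyclicCarry p h t a = l).card

lemma carrySum_of_le {p h t a : ℕ} (hph : p = 2 * h + 1) (hh : 0 < h) (ha : a ≤ repdigit p h t) :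
    digitSum p a + t * h = digitSum p (a + repdigit p h t) + (p - 1) * carrySum p h 0 t a := by
  have := two_mul_repdigit hph t
  simpa using digitSum_add_carrySum hph hh t (ε := 0) (a := a) (by omega) (by omega)

lemma carrySum_of_ge {p h t a : ℕ} (hph : p = 2 * h + 1) (hh : 0 < h) (ha : repdigit p h t ≤ a)
    (ha' : a ≤ 2 * repdigit p h t) :
    digitSum p a + t * h = digitSum p (a - repdigit p h t) + (p - 1) * carrySum p h 1 t a := by
  have h2 := two_mul_repdigit hph t
  have h1 := digitSum_add_carrySum hph hh t (ε := 1) (a := a) (by omega) (by omega)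
  rw [show a + repdigit p h t + 1 = p ^ t * 1 + (a - repdigit p h t) by omega,
    digitSum_pow_mul_add (by omega) _ _ (by omega), digitSum_of_lt (show 1 < p by omega)] at h1
  omega

lemma digitSum_two_mul_repdigit {p h : ℕ} (hph : p = 2 * h + 1) (hh : 0 < h) (t : ℕ) :
    digitSum p (2 * repdigit p h t) = t * (p - 1) := by
  have h2 := two_mul_repdigit hph t
  simpa using digitSum_add_complement (p := p) (by omega) t (a := 2 * repdigit p h t) (b := 0)
    (by omega)

lemma carrySum_zero_repdigit {p h : ℕ} (hph : p = 2 * h + 1) (hh : 0 < h) (t : ℕ) :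
    carrySum p h 0 t (repdigit p h t) = 0 := by
  have h1 := carrySum_of_le hph hh (le_refl (repdigit p h t))
  rw [← two_mul, digitSum_two_mul_repdigit hph hh, digitSum_repdigit (by omega) (by omega),
    show p - 1 = 2 * h by omega] at h1
  have : 2 * h * carrySum p h 0 t (repdigit p h t) = 0 := by
    have : t * (2 * h) = t * h + t * h := by ring
    omega
  rcases Nat.mul_eq_zero.1 this with h' | h' <;> omega

lemma carrySum_one_repdigit {p h : ℕ} (hph : p = 2 * h + 1) (hh : 0 < h) (t : ℕ) :
    carrySum p h 1 t (repdigit p h t) = t := by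
  have h1 := carrySum_of_ge hph hh (le_refl (repdigit p h t)) (by omega)
  rw [Nat.sub_self, digitSum_zero, digitSum_repdigit (by omega) (by omega),
    show p - 1 = 2 * h by omega] at h1
  apply Nat.eq_of_mul_eq_mul_left (show 0 < 2 * h by omega)
  linarith

lemma carrySum_one_two_mul_repdigit {p h : ℕ} (hph : p = 2 * h + 1) (hh : 0 < h) (t : ℕ) :
    carrySum p h 1 t (2 * repdigit p h t) = t := by
  have h1 := carrySum_of_ge hph hh (a := 2 * repdigit p h t) (by omega) le_rfl
  rw [two_mul (repdigit p h t), Nat.add_sub_cancel, ← two_mul, digitSum_two_mul_repdigit hph hh,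
    digitSum_repdigit (by omega) (by omega), show p - 1 = 2 * h by omega] at h1
  apply Nat.eq_of_mul_eq_mul_left (show 0 < 2 * h by omega)
  linarith

lemma trace_carryGF {p h t : ℕ} (hph : p = 2 * h + 1) (hh : 0 < h) (hk : 0 < repdigit p h t) :
    (carryGF p h t).trace = (∑ a ∈ Finset.range (2 * repdigit p h t), X ^ cyclicCarry p h t a) +
      2 * X ^ t := by
  have h2 := two_mul_repdigit hph t
  have h0 := carrySum_zero_repdigit hph hh t
  have h1 := carrySum_one_repdigit hph hh t
  have h3 := carrySum_one_two_mul_repdigit hph hh t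
  have key : ∀ a ∈ Finset.range (p ^ t),
      ((if (a + repdigit p h t + 0) / p ^ t = 0 then X ^ carrySum p h 0 t a else 0) +
        (if (a + repdigit p h t + 1) / p ^ t = 1 then X ^ carrySum p h 1 t a else 0) : ℚ[X]) =
      X ^ cyclicCarry p h t a + if a = repdigit p h t then X ^ t else 0 := by
    intro a ha
    rw [Finset.mem_range, ← h2] at ha
    unfold cyclicCarry
    rcases lt_trichotomy a (repdigit p h t) with hlt | rfl | hgt
    · rw [Nat.div_eq_of_lt (by omega), Nat.div_eq_of_lt (by omega)]
      simp [hlt.ne, hlt.le]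
    · rw [Nat.div_eq_of_lt (by omega), Nat.div_eq_of_lt_le (k := 1) (by omega) (by omega)]
      simp [h1]
    · rw [Nat.div_eq_of_lt_le (k := 1) (by omega) (by omega),
        Nat.div_eq_of_lt_le (k := 1) (by omega) (by omega)]
      simp [hgt.ne', hgt.not_ge]
  simp only [Matrix.trace_fin_two, carryGF, Matrix.of_apply, Fin.val_zero, Fin.val_one]
  rw [← Finset.sum_add_distrib, Finset.sum_congr rfl key, Finset.sum_add_distrib, ← h2,
    Finset.sum_range_succ, Finset.sum_ite_eq', if_pos (Finset.mem_range.2 (by omega)),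
    cyclicCarry, if_neg (by omega), h3]
  ring

lemma coeff_trace_carryGF {p h t : ℕ} (hph : p = 2 * h + 1) (hh : 0 < h)
    (hk : 0 < repdigit p h t) (l : ℕ) :
    (carryGF p h t).trace.coeff l = carryCount p h t l + if l = t then 2 else 0 := by
  rw [trace_carryGF hph hh hk, coeff_add, finsetSum_coeff, carryCount, Finset.card_filter]
  push_cast
  congr 1
  · exact Finset.sum_congr rfl fun a _ => by rw [coeff_X_pow]; simp [eq_comm]
  · rw [show (2 : ℚ[X]) = C 2 from (map_ofNat C 2).symm, coeff_C_mul, coeff_X_pow]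
    simp

lemma carryCount_add {p h t : ℕ} (hph : p = 2 * h + 1) (hh : 0 < h) (ht : 1 ≤ t)
    (hk : 0 < repdigit p h t) {l : ℕ} (hl : l ≤ t) :
    (carryCount p h t l : ℚ) + (if l = t then 2 else 0) =
      ∑ i ∈ Finset.range (min l (t - l) + 1),
        (t : ℚ) / ((t : ℚ) - (i : ℚ)) * ((t - i).choose i : ℚ) *
          ((t - 2 * i).choose (l - i) : ℚ) * (-(p : ℚ)) ^ i *
          (((h + 1 : ℕ) : ℚ)) ^ (t - 2 * i) := by
  rw [← coeff_trace_carryGF hph hh hk, carryGF_eq_pow hph hh, trace_carryTransfer_pow hph ht,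
    finsetSum_coeff]
  rw [← Finset.sum_subset (Finset.range_subset_range.2 (show min l (t - l) + 1 ≤ t + 1 by omega))]
  · refine Finset.sum_congr rfl fun i hi => ?_
    rw [Finset.mem_range] at hi
    rw [coeff_C_mul, coeff_X_pow_mul', if_pos (by omega), coeff_one_add_X_pow, waring]
    push_cast; ring
  · intro i _ hi
    rw [Finset.mem_range] at hi
    rw [coeff_C_mul, coeff_X_pow_mul']
    split_ifs with hil
    · rcases Nat.lt_or_ge t (2 * i) with h' | h'
      · rw [waring_eq_zero ht h']; simp
      · rw [coeff_one_add_X_pow, Nat.choose_eq_zero_of_lt (by omega)]; simp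
    · simp

lemma carryCount_top {p h t : ℕ} (hph : p = 2 * h + 1) (hh : 0 < h) (ht : 1 ≤ t)
    (hk : 0 < repdigit p h t) : carryCount p h t t = (h + 1) ^ t - 2 := by
  have h1 := carryCount_add hph hh ht hk le_rfl
  have ht0 : (t : ℚ) ≠ 0 := by positivity
  simp [ht0] at h1
  have h2 : carryCount p h t t + 2 = (h + 1) ^ t := by exact_mod_cast h1
  omega

end PaleySmith

/-! ### Equivalence of matrices and the Smith normal form over a valuation ring -/

namespace PaleySmith

open Matrix

section SmithEquiv

variable {R S m n : Type*} [CommRing R] [CommRing S]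
  [Fintype m] [DecidableEq m] [Fintype n] [DecidableEq n]

/-- Equivalence of square matrices: `N = P * M * Q` with `P` and `Q` invertible. -/
def SmithEquiv (M N : Matrix n n R) : Prop :=
  ∃ P Q : Matrix n n R, IsUnit P ∧ IsUnit Q ∧ P * M * Q = N

lemma SmithEquiv.symm {M N : Matrix n n R} (h : SmithEquiv M N) : SmithEquiv N M := by
  obtain ⟨P, Q, ⟨P, rfl⟩, ⟨Q, rfl⟩, rfl⟩ := h
  exact ⟨_, _, P⁻¹.isUnit, Q⁻¹.isUnit, by simp [mul_assoc]⟩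

lemma SmithEquiv.trans {M N K : Matrix n n R} (h : SmithEquiv M N) (h' : SmithEquiv N K) :
    SmithEquiv M K := by
  obtain ⟨P, Q, hP, hQ, rfl⟩ := h
  obtain ⟨P', Q', hP', hQ', rfl⟩ := h'
  exact ⟨P' * P, Q * Q', hP'.mul hP, hQ.mul hQ', by simp only [mul_assoc]⟩

lemma SmithEquiv.mul_right (M : Matrix n n R) {Q : Matrix n n R} (hQ : IsUnit Q) :
    SmithEquiv M (M * Q) :=
  ⟨1, Q, isUnit_one, hQ, by simp⟩

lemma SmithEquiv.map {M N : Matrix n n R} (h : SmithEquiv M N) (f : R →+* S) :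
    SmithEquiv (M.map f) (N.map f) := by
  obtain ⟨P, Q, hP, hQ, rfl⟩ := h
  exact ⟨P.map f, Q.map f, hP.map f.mapMatrix, hQ.map f.mapMatrix, by
    simp only [Matrix.map_mul]⟩

lemma SmithEquiv.submatrix {M N : Matrix n n R} (h : SmithEquiv M N) (e : m ≃ n) :
    SmithEquiv (M.submatrix e e) (N.submatrix e e) := by
  obtain ⟨P, Q, hP, hQ, rfl⟩ := h
  refine ⟨P.submatrix e e, Q.submatrix e e, ?_, ?_, ?_⟩
  · rwa [Matrix.isUnit_iff_isUnit_det, Matrix.det_submatrix_equiv_self,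
      ← Matrix.isUnit_iff_isUnit_det]
  · rwa [Matrix.isUnit_iff_isUnit_det, Matrix.det_submatrix_equiv_self,
      ← Matrix.isUnit_iff_isUnit_det]
  · simp only [Matrix.submatrix_mul_equiv]

lemma smithEquiv_submatrix_perm (M : Matrix n n R) (σ τ : Equiv.Perm n) :
    SmithEquiv M (M.submatrix σ τ) := by
  refine ⟨(1 : Matrix n n R).submatrix σ id, (1 : Matrix n n R).submatrix id τ, ?_, ?_, ?_⟩
  · rw [Matrix.isUnit_iff_isUnit_det, Matrix.det_permute, Matrix.det_one, mul_one]
    exact (Equiv.Perm.sign σ).isUnit.map (Int.castRingHom R)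
  · rw [Matrix.isUnit_iff_isUnit_det, Matrix.det_permute', Matrix.det_one, mul_one]
    exact (Equiv.Perm.sign τ).isUnit.map (Int.castRingHom R)
  · ext i j
    simp [Matrix.mul_apply, Matrix.one_apply]

lemma smithEquiv_diagonal_unit_mul {u d : n → R} (hu : ∀ i, IsUnit (u i)) :
    SmithEquiv (diagonal fun i => u i * d i) (diagonal d) := by
  refine SmithEquiv.symm ⟨diagonal u, 1, ?_, isUnit_one, by simp⟩
  rw [Matrix.isUnit_iff_isUnit_det, Matrix.det_diagonal]
  exact (Finset.univ : Finset n).prod_induction u _ (fun _ _ => IsUnit.mul) isUnit_one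
    fun i _ => hu i

lemma smithEquiv_fromBlocks (a : Matrix m m R) (b : Matrix m n R) (c : Matrix n m R)
    (D : Matrix n n R) :
    SmithEquiv (fromBlocks a (a * b) (c * a) D) (fromBlocks a 0 0 (D - c * a * b)) := by
  refine ⟨fromBlocks 1 0 (-c) 1, fromBlocks 1 (-b) 0 1, ?_, ?_, ?_⟩
  · simp [Matrix.isUnit_iff_isUnit_det]
  · simp [Matrix.isUnit_iff_isUnit_det]
  · simp [fromBlocks_multiply, Matrix.mul_assoc, sub_eq_neg_add]

lemma SmithEquiv.fromBlocks_zero (a : Matrix m m R) {D D' : Matrix n n R} (h : SmithEquiv D D') :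
    SmithEquiv (fromBlocks a 0 0 D) (fromBlocks a 0 0 D') := by
  obtain ⟨P, Q, hP, hQ, rfl⟩ := h
  rw [Matrix.isUnit_iff_isUnit_det] at hP hQ
  refine ⟨fromBlocks 1 0 0 P, fromBlocks 1 0 0 Q, ?_, ?_, ?_⟩
  · simpa [Matrix.isUnit_iff_isUnit_det] using hP
  · simpa [Matrix.isUnit_iff_isUnit_det] using hQ
  · simp [fromBlocks_multiply]

theorem exists_smithEquiv_diagonal [IsDomain R] [ValuationRing R] (N : ℕ) :
    ∀ M : Matrix (Fin N) (Fin N) R, ∃ d, SmithEquiv M (diagonal d) := by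
  induction N with
  | zero => intro M; exact ⟨0, 1, 1, isUnit_one, isUnit_one, Subsingleton.elim _ _⟩
  | succ N ih =>
    intro M
    obtain ⟨⟨i₀, j₀⟩, hdvd⟩ : ∃ z : Fin (N + 1) × Fin (N + 1), ∀ w : Fin (N + 1) × Fin (N + 1),
        M z.1 z.2 ∣ M w.1 w.2 := by
      let r : R → R → Prop := fun a b => b ∣ a
      have : IsTrans R r := ⟨fun a b c hab hbc => dvd_trans hbc hab⟩
      let f : Fin (N + 1) × Fin (N + 1) → R := fun w => M w.1 w.2
      suffices hf : Directed r f from hf.finite_le id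
      intro v w
      rcases ValuationRing.dvd_total (M v.1 v.2) (M w.1 w.2) with h | h
      · exact ⟨v, dvd_rfl, h⟩
      · exact ⟨w, h, dvd_rfl⟩
    simp only [Prod.forall] at hdvd
    let e : Unit ⊕ Fin N ≃ Fin (N + 1) :=
      ((Equiv.sumComm _ _).trans (Equiv.optionEquivSumPUnit _).symm).trans (finSuccEquiv N).symm
    have he : e (Sum.inl ()) = 0 := by simp [e]
    let M' := (M.submatrix (Equiv.swap 0 i₀) (Equiv.swap 0 j₀)).submatrix e e
    have hM' : M' (Sum.inl ()) (Sum.inl ()) = M i₀ j₀ := by simp [M', he]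
    have hdvd' : ∀ x y, M i₀ j₀ ∣ M' x y := fun x y => hdvd _ _
    choose g hg using hdvd'
    let A : Matrix Unit Unit R := diagonal fun _ => M i₀ j₀
    let B : Matrix Unit (Fin N) R := of fun _ y => g (Sum.inl ()) (Sum.inr y)
    let C : Matrix (Fin N) Unit R := of fun x _ => g (Sum.inr x) (Sum.inl ())
    have hblocks : M' = fromBlocks A (A * B) (C * A) (of fun x y => M' (Sum.inr x) (Sum.inr y)) := by
      ext x y
      rcases x with x | x <;> rcases y with y | y
      · simpa [A] using hM'
      · simpa [A, B] using hg _ _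
      · simpa [A, C, mul_comm] using hg _ _
      · rfl
    have h1 := smithEquiv_fromBlocks A B C (of fun x y => M' (Sum.inr x) (Sum.inr y))
    rw [← hblocks] at h1
    obtain ⟨d, hd⟩ := ih _
    have h2 := (h1.trans (SmithEquiv.fromBlocks_zero _ hd)).submatrix e.symm
    rw [fromBlocks_diagonal, submatrix_diagonal_equiv] at h2
    have h3 : M'.submatrix e.symm e.symm = M.submatrix (Equiv.swap 0 i₀) (Equiv.swap 0 j₀) := by
      ext; simp [M']
    rw [h3] at h2
    exact ⟨_, (smithEquiv_submatrix_perm M _ _).trans h2⟩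

end SmithEquiv

lemma card_exact_eq {R n : Type*} [CommRing R] [Fintype n] (ϖ : R) (d : n → R) (l : ℕ) :
    Nat.card {i // ϖ ^ l ∣ d i ∧ ¬ ϖ ^ (l + 1) ∣ d i} + Nat.card {i // ϖ ^ (l + 1) ∣ d i} =
      Nat.card {i // ϖ ^ l ∣ d i} := by
  classical
  simp only [Nat.card_eq_fintype_card, Fintype.card_subtype]
  rw [← Finset.card_filter_add_card_filter_not (s := Finset.univ.filter fun i => ϖ ^ l ∣ d i)
    (fun i => ϖ ^ (l + 1) ∣ d i), Finset.filter_filter, Finset.filter_filter, add_comm]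
  congr 2
  ext i
  simp only [Finset.mem_filter, Finset.mem_univ, true_and]
  exact ⟨fun h => ⟨(pow_dvd_pow ϖ l.le_succ).trans h, h⟩, fun h => h.2⟩

section Residue

variable {R k n : Type*} [CommRing R] [Field k] [Finite k] [Fintype n] [DecidableEq n]
  (π : R →+* k) (ϖ : R)

/-- The residues of the vectors which `M` maps into `ϖ ^ l` times the standard lattice. -/
def residueSet (M : Matrix n n R) (l : ℕ) : Set (n → k) :=
  {u | ∃ v : n → R, (∀ i, π (v i) = u i) ∧ ∀ i, ϖ ^ l ∣ (M *ᵥ v) i}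

lemma SmithEquiv.ncard_residueSet_le {M N : Matrix n n R} (h : SmithEquiv M N) (l : ℕ) :
    (residueSet π ϖ N l).ncard ≤ (residueSet π ϖ M l).ncard := by
  obtain ⟨P, Q, ⟨P, rfl⟩, hQ, rfl⟩ := h
  refine Set.ncard_le_ncard_of_injOn (fun u => Q.map π *ᵥ u) ?_
    ((Matrix.mulVec_injective_of_isUnit (hQ.map π.mapMatrix)).injOn) (Set.toFinite _)
  rintro u ⟨v, hv, hdvd⟩
  refine ⟨Q *ᵥ v, fun i => ?_, fun i => ?_⟩
  · rw [RingHom.map_mulVec]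
    congr 2
    exact funext hv
  · have : M *ᵥ (Q *ᵥ v) = (↑P⁻¹ : Matrix n n R) *ᵥ (((P : Matrix n n R) * M * Q) *ᵥ v) := by
      rw [mulVec_mulVec, mulVec_mulVec, mul_assoc, Units.inv_mul_cancel_left]
    rw [this]
    exact Finset.dvd_sum fun j _ => (hdvd j).mul_left _

variable {π ϖ}

lemma ncard_residueSet_diagonal [IsDomain R] (hπ : Function.Surjective π)
    (hker : ∀ x, π x = 0 ↔ ϖ ∣ x) (hϖ : Prime ϖ) (d : n → R) (l : ℕ) :
    (residueSet π ϖ (diagonal d) l).ncard = Nat.card k ^ Nat.card {i // ϖ ^ l ∣ d i} := by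
  classical
  have := Fintype.ofFinite k
  have hset : residueSet π ϖ (diagonal d) l =
      (Fintype.piFinset fun i => if ϖ ^ l ∣ d i then (Finset.univ : Finset k) else {0} :
        Finset (n → k)) := by
    ext u
    simp only [residueSet, mulVec_diagonal, Set.mem_ofPred_eq, Finset.mem_coe,
      Fintype.mem_piFinset]
    constructor
    · rintro ⟨v, hv, hdvd⟩ i
      split_ifs with hi
      · simp
      · rw [Finset.mem_singleton, ← hv, hker]
        by_contra hcon
        exact hi (hϖ.pow_dvd_of_dvd_mul_right l hcon (hdvd i))
    · intro hu
      choose w hw using fun i => hπ (u i)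
      refine ⟨fun i => if ϖ ^ l ∣ d i then w i else 0, fun i => ?_, fun i => ?_⟩ <;> beta_reduce
      · have := hu i
        split_ifs with hi
        · exact hw i
        · simp_all
      · split_ifs with hi
        · exact hi.mul_right _
        · simp
  rw [hset, Set.ncard_coe_finset, Fintype.card_piFinset]
  simp only [apply_ite Finset.card, Finset.card_univ, Finset.card_singleton]
  rw [Finset.prod_ite, Finset.prod_const, Finset.prod_const_one, mul_one,
    Nat.card_eq_fintype_card, Nat.card_eq_fintype_card, Fintype.card_subtype]

theorem SmithEquiv.card_dvd_eq [IsDomain R] (hπ : Function.Surjective π)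
    (hker : ∀ x, π x = 0 ↔ ϖ ∣ x) (hϖ : Prime ϖ) {d d' : n → R} (h : SmithEquiv (diagonal d) (diagonal d')) (l : ℕ) :
    Nat.card {i // ϖ ^ l ∣ d i} = Nat.card {i // ϖ ^ l ∣ d' i} := by
  have h1 := h.ncard_residueSet_le π ϖ l
  have h2 := h.symm.ncard_residueSet_le π ϖ l
  have h3 := le_antisymm h2 h1
  rw [ncard_residueSet_diagonal hπ hker hϖ, ncard_residueSet_diagonal hπ hker hϖ] at h3
  exact Nat.pow_right_injective (Finite.one_lt_card) h3

end Residue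

end PaleySmith

/-! ### Jacobi sums of Teichmüller characters -/

namespace PaleySmith

section Choose

variable {p h t : ℕ}

lemma pow_cyclicCarry_dvd_choose (hp : p.Prime) (hph : p = 2 * h + 1) (hh : 0 < h) {a m : ℕ}
    (ha : 0 < a) (hak : a ≠ repdigit p h t) (ha2 : a < 2 * repdigit p h t) (w : ℕ)
    (hm : m ≤ repdigit p h t * (p ^ t) ^ w)
    (hma : m ≡ a [MOD 2 * repdigit p h t]) :
    p ^ cyclicCarry p h t a ∣ (repdigit p h t * (p ^ t) ^ w).choose m := by
  have hq := two_mul_repdigit hph t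
  have hq' : p ^ t - 1 = 2 * repdigit p h t := by omega
  generalize hk : repdigit p h t = k at *
  have hpos : (k * (p ^ t) ^ w).choose m ≠ 0 := (Nat.choose_pos hm).ne'
  have := Fact.mk hp
  rw [padicValNat_dvd_iff_le hpos]
  have hleg := sub_one_mul_padicValNat_choose_eq_sub_sum_digits (p := p) hm
  simp only [← digitSum.eq_1] at hleg
  have hsk : digitSum p (k * (p ^ t) ^ w) = t * h := by
    rw [← pow_mul, mul_comm, digitSum_pow_mul hp.one_lt, ← hk,
      digitSum_repdigit hp.one_lt (by omega)]
  have hsm : digitSum p a ≤ digitSum p m := by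
    have := digitSum_mod_le hp t m
    rwa [hq', hma, Nat.mod_eq_of_lt ha2] at this
  set n := k * (p ^ t) ^ w - m with hn
  have hnk : n + m ≡ k [MOD 2 * k] := by
    have h1 : (p ^ t) ^ w ≡ 1 [MOD 2 * k] := by
      have : p ^ t ≡ 1 [MOD 2 * k] := by
        rw [← hq]; simp [Nat.ModEq]
      simpa using this.pow w
    have h2 := h1.mul_left k
    rw [mul_one] at h2
    rwa [show n + m = k * (p ^ t) ^ w by omega]
  have hna : n + a ≡ k [MOD 2 * k] := (hma.symm.add_left n).trans hnk
  have hsn : digitSum p (n % (2 * k)) ≤ digitSum p n := by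
    have := digitSum_mod_le hp t n
    rwa [hq'] at this
  have key : digitSum p a + digitSum p (n % (2 * k)) =
      t * h + (p - 1) * cyclicCarry p h t a := by
    have hp1 : t * (p - 1) = t * h + t * h := by rw [hph]; simp; ring
    unfold cyclicCarry
    rcases lt_or_gt_of_ne hak with hlt | hgt
    · have hmod : n % (2 * k) = k - a := by
        have : n ≡ k - a [MOD 2 * k] := by
          apply Nat.ModEq.add_right_cancel' a
          rwa [Nat.sub_add_cancel hlt.le]
        rw [this, Nat.mod_eq_of_lt (by omega)]
      have h1 := carrySum_of_le hph hh (t := t) (a := a) (by omega)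
      have h2 := digitSum_add_complement hp.one_lt t (a := k - a) (b := a + k) (by omega)
      rw [hk] at h1 ⊢
      rw [if_pos hlt.le, hmod]
      omega
    · have hmod : n % (2 * k) = 3 * k - a := by
        have : n ≡ 3 * k - a [MOD 2 * k] := by
          apply Nat.ModEq.add_right_cancel' a
          rw [Nat.sub_add_cancel (by omega)]
          refine hna.trans ?_
          rw [show 3 * k = k + 2 * k by ring]
          simp [Nat.ModEq]
        rw [this, Nat.mod_eq_of_lt (by omega)]
      have h1 := carrySum_of_ge hph hh (t := t) (a := a) (by omega) (by omega)
      have h2 := digitSum_add_complement hp.one_lt t (a := 3 * k - a) (b := a - k) (by omega)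
      rw [hk] at h1 ⊢
      rw [if_neg (by omega), hmod]
      omega
  have hp0 : 0 < p - 1 := by omega
  refine Nat.le_of_mul_le_mul_left ?_ hp0
  rw [hleg, hsk]
  omega

lemma cyclicCarry_add_cyclicCarry (hph : p = 2 * h + 1) (hh : 0 < h) {a : ℕ}
    (ha : 0 < a) (hak : a ≤ repdigit p h t) :
    cyclicCarry p h t a + cyclicCarry p h t (a + repdigit p h t) = t := by
  have h1 := carrySum_of_le hph hh (t := t) (a := a) hak
  have h2 := carrySum_of_ge hph hh (t := t) (a := a + repdigit p h t) (by omega) (by omega)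
  rw [Nat.add_sub_cancel] at h2
  unfold cyclicCarry
  rw [if_pos hak, if_neg (by omega)]
  have hp1 : p - 1 = 2 * h := by omega
  rw [hp1] at h1 h2
  have : 2 * h * (carrySum p h 0 t a + carrySum p h 1 t (a + repdigit p h t)) = 2 * h * t := by
    rw [mul_add, mul_assoc 2 h t, mul_comm h t]; omega
  exact Nat.eq_of_mul_eq_mul_left (by omega) this

end Choose

section Jacobi

variable {R F : Type*} [CommRing R] [Field F]

/-- `T` is a multiplicative section of the residue map `π` of a local domain with
maximal ideal generated by `p`. -/
structure IsTeichmuller (p : ℕ) (π : R →+* F) (T : F →* R) : Prop where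
  map_zero : T 0 = 0
  residue : ∀ x, π (T x) = x
  ker : ∀ x, π x = 0 ↔ (p : R) ∣ x
  isUnit : ∀ x, π x ≠ 0 → IsUnit x
  prime : Prime (p : R)

/-- The Jacobi sum of the `k`-th and `j`-th powers of the Teichmüller character. -/
def jacobi [Fintype F] (T : F →* R) (k j : ℕ) : R := ∑ u, T (1 - u) ^ k * T u ^ j

variable {p k : ℕ} {π : R →+* F} {T : F →* R}

namespace IsTeichmuller

lemma injective (hT : IsTeichmuller p π T) : Function.Injective T :=
  Function.LeftInverse.injective hT.residue

lemma neg_pow (hk : Even k) (x : F) : T (-x) ^ k = T x ^ k := by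
  rw [← map_pow, ← map_pow, hk.neg_pow]

variable [Fintype F]

lemma pow_two_mul (hF : Fintype.card F = 2 * k + 1) {x : F} (hx : x ≠ 0) :
    T x ^ (2 * k) = 1 := by
  have := FiniteField.pow_card_sub_one_eq_one x hx
  rw [hF, Nat.add_sub_cancel] at this
  rw [← map_pow, this, map_one]

lemma sum_sub_mul_pow (x : F) (hx : x ≠ 0) (j : ℕ) :
    ∑ y, T (x - y) ^ k * T y ^ j = jacobi T k j * T x ^ (j + k) := by
  rw [jacobi, Finset.sum_mul]
  refine (Fintype.sum_equiv (Equiv.mulLeft₀ x hx) _ _ fun u => ?_).symm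
  rw [Equiv.mulLeft₀_apply, show x - x * u = x * (1 - u) by ring, map_mul, map_mul]
  ring

lemma sum_neg_mul_pow (hke : Even k) (j : ℕ) :
    ∑ y, T (0 - y) ^ k * T y ^ j = ∑ y, T y ^ (j + k) := by
  refine Finset.sum_congr rfl fun y _ => ?_
  rw [zero_sub, neg_pow hke, ← pow_add, add_comm]

variable [IsDomain R]

lemma sum_pow (hT : IsTeichmuller p π T) (hF : Fintype.card F = 2 * k + 1) {n : ℕ} (hn : n ≠ 0) :
    ∑ x, T x ^ n = if 2 * k ∣ n then (2 * k : R) else 0 := by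
  classical
  have hcard : Nat.card F = 2 * k + 1 := by rw [Nat.card_eq_fintype_card, hF]
  have hiff := FiniteField.forall_pow_eq_one_iff F n
  rw [hF, Nat.add_sub_cancel] at hiff
  split_ifs with h
  · obtain ⟨c, rfl⟩ := h
    have : ∀ x : F, T x ^ (2 * k * c) = 1 - if x = 0 then 1 else 0 := by
      intro x
      split_ifs with hx
      · rw [hx, hT.map_zero, zero_pow hn, sub_self]
      · rw [pow_mul, pow_two_mul hF hx, one_pow, sub_zero]
    simp [this, hF]
  · rw [← hiff] at h
    push Not at h
    obtain ⟨g, hg⟩ := h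
    have hg1 : T g ^ n ≠ 1 := fun hcon => hg <| Units.ext <| hT.injective <| by
      rw [Units.val_pow_eq_pow_val, map_pow, hcon, Units.val_one, map_one]
    have hS : T g ^ n * ∑ x, T x ^ n = ∑ x, T x ^ n := by
      rw [Finset.mul_sum]
      refine Fintype.sum_equiv (Units.mulLeft g) _ _ fun x => ?_
      rw [Units.mulLeft_apply, map_mul, mul_pow]
    have : (T g ^ n - 1) * ∑ x, T x ^ n = 0 := by rw [sub_mul, hS, one_mul, sub_self]
    exact (mul_eq_zero.1 this).resolve_left (sub_ne_zero.2 hg1)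

lemma sum_sub_pow (hT : IsTeichmuller p π T) (hF : Fintype.card F = 2 * k + 1) (hk : 0 < k)
    (x : F) : ∑ y, T (x - y) ^ k = 0 := by
  rw [Fintype.sum_equiv (Equiv.subLeft x) (fun y => T (x - y) ^ k) (fun y => T y ^ k)
    (fun _ => rfl), hT.sum_pow hF hk.ne', if_neg]
  exact fun h => absurd (Nat.le_of_dvd hk h) (by omega)

lemma jacobi_two_mul (hT : IsTeichmuller p π T) (hF : Fintype.card F = 2 * k + 1) (hk : 0 < k) :
    jacobi T k (2 * k) = -1 := by
  classical
  have : ∀ u : F, T (1 - u) ^ k * T u ^ (2 * k) = T (1 - u) ^ k - if u = 0 then 1 else 0 := by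
    intro u
    split_ifs with hu
    · rw [hu, hT.map_zero, zero_pow (by omega)]; simp
    · rw [pow_two_mul hF hu]; simp
  simp [jacobi, this, hT.sum_sub_pow hF hk]

lemma jacobi_self (hT : IsTeichmuller p π T) (hF : Fintype.card F = 2 * k + 1) (hk : 0 < k)
    (hke : Even k) : jacobi T k k = -1 := by
  classical
  have : ∀ u : F, T (1 - u) ^ k * T u ^ k = T (1 - u⁻¹) ^ k - if u = 0 then 1 else 0 := by
    intro u
    split_ifs with hu
    · rw [hu, hT.map_zero, zero_pow (by omega)]; simp
    · have h1 : T (1 - u) = T u * T (-(1 - u⁻¹)) := by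
        rw [← map_mul]; congr 1; field_simp; ring
      rw [h1, mul_pow, neg_pow hke, mul_right_comm, ← pow_add, ← two_mul, pow_two_mul hF hu]
      simp
  rw [jacobi]
  simp only [this, Finset.sum_sub_distrib]
  rw [Fintype.sum_equiv (Equiv.inv F) (fun u => T (1 - u⁻¹) ^ k) (fun u => T (1 - u) ^ k)
    (fun _ => rfl), hT.sum_sub_pow hF hk]
  simp

lemma sum_autocorrelation [DecidableEq F] (hT : IsTeichmuller p π T)
    (hF : Fintype.card F = 2 * k + 1)
    (hk : 0 < k) (hke : Even k) (x y : F) :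
    ∑ z, T (x - z) ^ k * T (z - y) ^ k = if x = y then (2 * k : R) else -1 := by
  have h1 : ∑ z, T (x - z) ^ k * T (z - y) ^ k = ∑ u, T (x - y - u) ^ k * T u ^ k := by
    refine Fintype.sum_equiv (Equiv.subRight y) _ _ fun z => ?_
    simp
  rw [h1]
  split_ifs with h
  · rw [h, sub_self, sum_neg_mul_pow hke, ← two_mul, hT.sum_pow hF (by omega), if_pos dvd_rfl]
  · rw [sum_sub_mul_pow _ (sub_ne_zero.2 h), hT.jacobi_self hF hk hke, ← two_mul,
      pow_two_mul hF (sub_ne_zero.2 h), mul_one]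

lemma jacobi_mul_jacobi (hT : IsTeichmuller p π T) (hF : Fintype.card F = 2 * k + 1)
    (hke : Even k) {j : ℕ} (hj : 0 < j) (hjk : j < k) :
    jacobi T k j * jacobi T k (j + k) = (2 * k + 1 : R) := by
  classical
  have hdvd : ∀ n, 0 < n → n < 2 * k → ¬ 2 * k ∣ n := fun n h0 h1 h =>
    absurd (Nat.le_of_dvd h0 h) (by omega)
  have h1 : ∀ z : F, ∑ y, T (z - y) ^ k * T y ^ j = jacobi T k j * T z ^ (j + k) := by
    intro z
    by_cases hz : z = 0
    · rw [hz, sum_neg_mul_pow hke, hT.sum_pow hF (by omega), if_neg (hdvd _ (by omega) (by omega)),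
        hT.map_zero, zero_pow (by omega), mul_zero]
    · exact sum_sub_mul_pow z hz j
  have h2 : ∑ z, T (1 - z) ^ k * ∑ y, T (z - y) ^ k * T y ^ j =
      jacobi T k j * jacobi T k (j + k) := by
    simp only [h1]
    rw [jacobi.eq_1 T k (j + k), Finset.mul_sum]
    exact Finset.sum_congr rfl fun z _ => by ring
  rw [← h2]
  simp only [Finset.mul_sum, ← mul_assoc]
  rw [Finset.sum_comm]
  simp only [← Finset.sum_mul, hT.sum_autocorrelation hF (by omega) hke]
  have h3 : ∀ y : F, (if 1 = y then (2 * k : R) else -1) * T y ^ j =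
      (if 1 = y then (2 * k + 1 : R) else 0) - T y ^ j := by
    intro y
    split_ifs with h
    · rw [← h, map_one, one_pow]; ring
    · ring
  simp only [h3, Finset.sum_sub_distrib]
  rw [hT.sum_pow hF (by omega), if_neg (hdvd _ hj (by omega))]
  simp

lemma pow_cyclicCarry_dvd_jacobi {h t : ℕ} (hT : IsTeichmuller p π T)
    (hF : Fintype.card F = p ^ t) (ht : t ≠ 0) (hp : p.Prime) (hph : p = 2 * h + 1) (hh : 0 < h)
    {j : ℕ} (hj : 0 < j)
    (hjk : j ≠ repdigit p h t) (hj2 : j < 2 * repdigit p h t) :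
    (p : R) ^ cyclicCarry p h t (2 * repdigit p h t - j) ∣ jacobi T (repdigit p h t) j := by
  have hq := two_mul_repdigit hph t
  set k := repdigit p h t with hk
  set w := cyclicCarry p h t (2 * k - j) with hw
  have hFk : Fintype.card F = 2 * k + 1 := by omega
  have hcong : ∀ u : F, (p : R) ^ w ∣ T (1 - u) ^ k - (1 - T u) ^ (k * (p ^ t) ^ w) := by
    intro u
    have h0 : (p : R) ∣ T (1 - u) - (1 - T u) := by
      rw [← hT.ker, map_sub π, map_sub π, hT.residue, hT.residue, map_one π, sub_self]
    have h1 := dvd_sub_pow_of_dvd_sub h0 (t * w)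
    have h2 : T (1 - u) ^ p ^ (t * w) = T (1 - u) := by
      rw [← map_pow, pow_mul, ← hF, FiniteField.pow_card_pow]
    rw [h2] at h1
    have h3 : w ≤ t * w + 1 :=
      (Nat.le_mul_of_pos_left w (Nat.pos_of_ne_zero ht)).trans (Nat.le_succ _)
    have h4 := (pow_dvd_pow (p : R) h3).trans h1
    rw [mul_comm k, pow_mul, ← pow_mul p]
    exact h4.trans (sub_dvd_pow_sub_pow _ _ k)
  have hsum : (p : R) ^ w ∣ jacobi T k j - ∑ u, (1 - T u) ^ (k * (p ^ t) ^ w) * T u ^ j := by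
    rw [jacobi, ← Finset.sum_sub_distrib]
    refine Finset.dvd_sum fun u _ => ?_
    rw [← sub_mul]
    exact (hcong u).mul_right _
  rw [dvd_iff_dvd_of_dvd_sub hsum]
  have hexp : ∑ u, (1 - T u) ^ (k * (p ^ t) ^ w) * T u ^ j =
      ∑ m ∈ Finset.range (k * (p ^ t) ^ w + 1),
        ((k * (p ^ t) ^ w).choose m : R) * (-1) ^ m * ∑ u, T u ^ (m + j) := by
    simp only [Finset.mul_sum]
    rw [Finset.sum_comm]
    refine Finset.sum_congr rfl fun u _ => ?_
    rw [sub_eq_neg_add, add_pow, Finset.sum_mul]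
    refine Finset.sum_congr rfl fun m _ => ?_
    rw [one_pow, _root_.neg_pow, pow_add]
    ring
  rw [hexp]
  refine Finset.dvd_sum fun m hm => ?_
  rw [hT.sum_pow hFk (by omega)]
  split_ifs with hdvd
  · refine Dvd.dvd.mul_right (Dvd.dvd.mul_right ?_ _) _
    have := pow_cyclicCarry_dvd_choose hp hph hh (t := t) (a := 2 * k - j) (m := m)
      (by omega) (by omega) (by omega) w (by simpa [Nat.lt_succ_iff] using hm) (by
        apply Nat.ModEq.add_right_cancel' j
        rw [Nat.sub_add_cancel (by omega)]
        exact ((Nat.modEq_zero_iff_dvd).2 hdvd).trans (by simp [Nat.ModEq, hk]))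
    exact_mod_cast Nat.cast_dvd_cast (α := R) this
  · simp

end IsTeichmuller

end Jacobi

end PaleySmith

/-! ### The Paley matrix over a ring with Teichmüller lifts -/

namespace PaleySmith

open Matrix

/-- The elementary divisors of the Paley Laplacian: `0` at index `0`, and
`p ^ cyclicCarry p h t (2 * k - j)` at index `j ≠ 0`, where `k = repdigit p h t`. -/
def paleyDivisor (R : Type*) [CommRing R] (p h t j : ℕ) : R :=
  if j = 0 then 0 else (p : R) ^ cyclicCarry p h t (2 * repdigit p h t - j)

lemma card_paleyDivisor {R : Type*} [CommRing R] [IsDomain R] {p h t N : ℕ} (hp : Prime (p : R))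
    (hN : N = 2 * repdigit p h t + 1) (l : ℕ) :
    Nat.card {j : Fin N // (p : R) ^ l ∣ paleyDivisor R p h t j ∧
      ¬ (p : R) ^ (l + 1) ∣ paleyDivisor R p h t j} = carryCount p h t l := by
  classical
  subst hN
  have hiff : ∀ c, (p : R) ^ l ∣ (p : R) ^ c ∧ ¬ (p : R) ^ (l + 1) ∣ (p : R) ^ c ↔ c = l := by
    intro c
    rw [pow_dvd_pow_iff hp.ne_zero hp.not_isUnit, pow_dvd_pow_iff hp.ne_zero hp.not_isUnit]
    omega
  rw [Nat.card_eq_fintype_card, Fintype.card_subtype, carryCount]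
  refine Finset.card_bij' (fun j _ => 2 * repdigit p h t - (j : ℕ))
    (fun a _ => Fin.ofNat _ (2 * repdigit p h t - a)) ?_ ?_ ?_ ?_
  · intro j hj
    have hj' := (Finset.mem_filter.1 hj).2
    unfold paleyDivisor at hj'
    split_ifs at hj' with h0
    · exact absurd (dvd_zero _) hj'.2
    · rw [hiff] at hj'
      simp only [Finset.mem_filter, Finset.mem_range]
      exact ⟨by omega, hj'⟩
  · intro a ha
    obtain ⟨ha1, ha2⟩ := Finset.mem_filter.1 ha
    rw [Finset.mem_range] at ha1
    simp only [Finset.mem_filter, Finset.mem_univ, true_and, Fin.ofNat_eq_cast, Fin.val_natCast]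
    rw [Nat.mod_eq_of_lt (by omega), paleyDivisor, if_neg (by omega), hiff, ← ha2]
    congr 1
    omega
  · intro j hj
    have hj' := (Finset.mem_filter.1 hj).2
    ext
    have := j.2
    simp only [Fin.ofNat_eq_cast, Fin.val_natCast]
    rw [Nat.mod_eq_of_lt (by omega)]
    omega
  · intro a ha
    obtain ⟨ha1, ha2⟩ := Finset.mem_filter.1 ha
    rw [Finset.mem_range] at ha1
    simp only [Fin.ofNat_eq_cast, Fin.val_natCast]
    rw [Nat.mod_eq_of_lt (by omega)]
    omega

/-- The involution of `{0, …, 2k}` fixing `0` and sending `j` to the representative of `-(j + k)`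
modulo `2k` in `{1, …, 2k}`. -/
def reflect (k : ℕ) : Equiv.Perm (Fin (2 * k + 1)) :=
  Function.Involutive.toPerm
    (fun j => if h0 : (j : ℕ) = 0 then j else if h : (j : ℕ) < k then ⟨k - j, by omega⟩
      else ⟨3 * k - j, by omega⟩) <| by
    intro j
    have := j.2
    ext
    grind

lemma val_reflect_eq_iff {k : ℕ} (hk : 0 < k) (i j : Fin (2 * k + 1)) (hj : (j : ℕ) ≠ 0) :
    2 * k ∣ (reflect k i : ℕ) + j + k ∧ (reflect k i : ℕ) ≠ 0 ↔ i = j := by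
  have hj2 := j.2
  have hi2 := i.2
  have hr : (reflect k i : ℕ) = if (i : ℕ) = 0 then 0 else if (i : ℕ) < k then k - i
      else 3 * k - i := by
    change ((if h0 : (i : ℕ) = 0 then i else if h : (i : ℕ) < k then ⟨k - i, by omega⟩
      else ⟨3 * k - i, by omega⟩ : Fin (2 * k + 1)) : ℕ) = _
    split_ifs with h0 h1
    exacts [h0, rfl, rfl]
  rw [hr, Fin.ext_iff]
  constructor
  · rintro ⟨⟨c, hc⟩, h⟩
    split_ifs at hc h with h0 h1
    · exact absurd rfl h
    · have : c < 3 := by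
        by_contra! h3
        have := Nat.mul_le_mul_left (2 * k) h3
        omega
      interval_cases c <;> omega
    · have : c < 3 := by
        by_contra! h3
        have := Nat.mul_le_mul_left (2 * k) h3
        omega
      interval_cases c <;> omega
  · intro h
    rw [h, if_neg hj]
    split_ifs with h1
    · exact ⟨⟨1, by omega⟩, by omega⟩
    · exact ⟨⟨2, by omega⟩, by omega⟩

section

variable {R F : Type*} [CommRing R] [Field F]
  {p h t k : ℕ} {π : R →+* F} {T : F →* R}

/-- The matrix `T (x - y) ^ k`, which for `2 * k + 1 = #F` is the quadratic character matrix. -/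
def paleyMatrix (T : F →* R) (k : ℕ) : Matrix F F R := of fun x y => T (x - y) ^ k

namespace IsTeichmuller

lemma isUnit_vandermonde (hT : IsTeichmuller p π T) {N : ℕ} (e : Fin N ≃ F) :
    IsUnit (vandermonde fun i => T (e i)) := by
  rw [isUnit_iff_isUnit_det, det_vandermonde]
  refine Finset.prod_induction _ _ (fun _ _ => IsUnit.mul) isUnit_one fun i _ =>
    Finset.prod_induction _ _ (fun _ _ => IsUnit.mul) isUnit_one fun j hj => hT.isUnit _ ?_
  rw [map_sub, hT.residue, hT.residue, sub_ne_zero]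
  exact fun hij => (Finset.mem_Ioi.1 hj).ne' (e.injective hij)

variable [Fintype F]

lemma isUnit_two_mul (hT : IsTeichmuller p π T) (hF : Fintype.card F = 2 * k + 1) :
    IsUnit (2 * k : R) := by
  apply hT.isUnit
  have := FiniteField.cast_card_eq_zero F
  rw [hF] at this
  push_cast at this
  rw [map_mul, map_ofNat, map_natCast, eq_neg_of_add_eq_zero_left this]
  exact neg_ne_zero.2 one_ne_zero

variable [IsDomain R]

lemma exists_unit_jacobi (hT : IsTeichmuller p π T) (hF : Fintype.card F = p ^ t) (ht : t ≠ 0)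
    (hp : p.Prime) (hph : p = 2 * h + 1) (hh : 0 < h) (hke : Even (repdigit p h t))
    {j : ℕ} (hj : 0 < j) (hj2 : j ≤ 2 * repdigit p h t) :
    ∃ u : R, IsUnit u ∧ jacobi T (repdigit p h t) j = u * paleyDivisor R p h t j := by
  have hq := two_mul_repdigit hph t
  have hlow := fun i hi => hT.pow_cyclicCarry_dvd_jacobi hF ht hp hph hh (j := i) hi
  have hcc := fun a ha => cyclicCarry_add_cyclicCarry hph hh (t := t) (a := a) ha
  have hck : cyclicCarry p h t (repdigit p h t) = 0 := by
    rw [cyclicCarry, if_pos le_rfl, carrySum_zero_repdigit hph hh]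
  have hc0 : cyclicCarry p h t 0 = 0 := by
    have := carrySum_of_le hph hh (t := t) (a := 0) (Nat.zero_le _)
    rw [zero_add, digitSum_zero, digitSum_repdigit hp.one_lt (by omega)] at this
    rw [cyclicCarry, if_pos (Nat.zero_le _)]
    refine (Nat.mul_eq_zero.1 (show (p - 1) * _ = 0 by omega)).resolve_left (by omega)
  unfold paleyDivisor
  generalize repdigit p h t = k at *
  have hFk : Fintype.card F = 2 * k + 1 := by omega
  rw [if_neg hj.ne']
  have hdual : ∀ j, 0 < j → j < k → ∃ u v : R, u * v = 1 ∧
      jacobi T k j = u * (p : R) ^ cyclicCarry p h t (2 * k - j) ∧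
      jacobi T k (j + k) = v * (p : R) ^ cyclicCarry p h t (2 * k - (j + k)) := by
    intro j h0 hjk
    obtain ⟨u, hu⟩ := hlow j h0 (by omega) (by omega)
    obtain ⟨v, hv⟩ := hlow (j + k) (by omega) (by omega) (by omega)
    refine ⟨u, v, ?_, by rw [hu, mul_comm], by rw [hv, mul_comm]⟩
    have h1 := hT.jacobi_mul_jacobi hFk hke h0 hjk
    have h2 := hcc (k - j) (by omega) (by omega)
    rw [show k - j + k = 2 * k - j by omega, show k - j = 2 * k - (j + k) by omega] at h2
    have h3 : (2 * k + 1 : R) = (p : R) ^ t := by exact_mod_cast congrArg (Nat.cast (R := R)) hq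
    have h5 : (p : R) ^ t = (p : R) ^ cyclicCarry p h t (2 * k - (j + k)) *
        (p : R) ^ cyclicCarry p h t (2 * k - j) := by rw [← pow_add, h2]
    rw [h3, hu, hv, h5] at h1
    have h4 : (p : R) ^ cyclicCarry p h t (2 * k - (j + k)) *
        (p : R) ^ cyclicCarry p h t (2 * k - j) ≠ 0 :=
      mul_ne_zero (pow_ne_zero _ hT.prime.ne_zero) (pow_ne_zero _ hT.prime.ne_zero)
    apply mul_left_cancel₀ h4
    rw [mul_one]
    linear_combination h1
  rcases lt_trichotomy j k with hlt | heq | hgt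
  · obtain ⟨u, v, huv, hu, -⟩ := hdual j hj hlt
    exact ⟨u, .of_mul_eq_one v huv, hu⟩
  · refine ⟨-1, isUnit_one.neg, ?_⟩
    rw [heq, hT.jacobi_self hFk (by omega) hke, show 2 * k - k = k by omega, hck, pow_zero, mul_one]
  · rcases hj2.lt_or_eq with hlt | heq
    · obtain ⟨u, v, huv, -, hv⟩ := hdual (j - k) (by omega) (by omega)
      rw [Nat.sub_add_cancel hgt.le] at hv
      exact ⟨v, .of_mul_eq_one u (by rw [mul_comm, huv]), hv⟩
    · refine ⟨-1, isUnit_one.neg, ?_⟩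
      rw [heq, hT.jacobi_two_mul hFk (by omega), Nat.sub_self, hc0, pow_zero, mul_one]

lemma sum_sum_mul (hT : IsTeichmuller p π T) (hF : Fintype.card F = 2 * k + 1) (hk : 0 < k)
    (hke : Even k) {i : ℕ} (j : ℕ) :
    ∑ x, T x ^ i * ∑ y, T (x - y) ^ k * T y ^ j =
      if 2 * k ∣ i + j + k ∧ i ≠ 0 then 2 * k * jacobi T k j else 0 := by
  by_cases hi : i = 0
  · rw [if_neg (fun h => h.2 hi), hi]
    simp only [Finset.mul_sum]
    rw [Finset.sum_comm]
    refine Finset.sum_eq_zero fun y _ => ?_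
    simp only [pow_zero, one_mul, ← Finset.sum_mul]
    have : ∑ x, T (x - y) ^ k = 0 := by
      rw [← hT.sum_sub_pow hF hk y]
      refine Finset.sum_congr rfl fun x _ => ?_
      rw [← neg_sub, neg_pow hke]
    rw [this, zero_mul]
  · have h1 : ∀ x : F, T x ^ i * ∑ y, T (x - y) ^ k * T y ^ j =
        jacobi T k j * T x ^ (i + j + k) := by
      intro x
      by_cases hx : x = 0
      · rw [hx, hT.map_zero, zero_pow hi, zero_pow (by omega), mul_zero, zero_mul]
      · rw [sum_sub_mul_pow x hx]; ring
    simp only [h1, ← Finset.mul_sum]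
    rw [hT.sum_pow hF (by omega)]
    simp only [hi, ne_eq, not_false_eq_true, and_true]
    split_ifs <;> ring

theorem smithEquiv_paleyMatrix (hT : IsTeichmuller p π T) (hF : Fintype.card F = p ^ t)
    (ht : t ≠ 0) (hp : p.Prime) (hph : p = 2 * h + 1) (hh : 0 < h) (hk : 0 < repdigit p h t)
    (hke : Even (repdigit p h t)) (e : Fin (2 * repdigit p h t + 1) ≃ F) :
    SmithEquiv ((paleyMatrix T (repdigit p h t)).submatrix e e)
      (diagonal fun j => paleyDivisor R p h t j) := by
  have hq := two_mul_repdigit hph t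
  have hu := fun j hj => hT.exists_unit_jacobi hF ht hp hph hh hke (j := j) hj
  generalize repdigit p h t = k at *
  have hFk : Fintype.card F = 2 * k + 1 := by omega
  let V := vandermonde fun i => T (e i)
  have hV : IsUnit V := hT.isUnit_vandermonde e
  let Y := Vᵀ * (paleyMatrix T k).submatrix e e * V
  have hY : ∀ i j, Y i j = ∑ x, T x ^ (i : ℕ) * ∑ y, T (x - y) ^ k * T y ^ (j : ℕ) := by
    intro i j
    simp only [Y, V, Matrix.mul_assoc]
    rw [Matrix.mul_apply]
    refine Fintype.sum_equiv e _ _ fun a => ?_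
    rw [Matrix.mul_apply]
    congr 1
    exact Fintype.sum_equiv e _ _ fun b => rfl
  have hex : ∀ j : Fin (2 * k + 1), ∃ u : R, IsUnit u ∧
      (if (j : ℕ) = 0 then 0 else 2 * k * jacobi T k j) = u * paleyDivisor R p h t j := by
    intro j
    by_cases hj : (j : ℕ) = 0
    · exact ⟨1, isUnit_one, by simp [hj, paleyDivisor]⟩
    · obtain ⟨u, hu1, hu2⟩ := hu j (by omega) (by omega)
      exact ⟨2 * k * u, (hT.isUnit_two_mul hFk).mul hu1, by rw [if_neg hj, hu2]; ring⟩
  choose u hu1 hu2 using hex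
  have h1 : SmithEquiv ((paleyMatrix T k).submatrix e e) Y :=
    ⟨Vᵀ, V, by rw [isUnit_iff_isUnit_det, det_transpose, ← isUnit_iff_isUnit_det]; exact hV, hV, rfl⟩
  have h2 : Y.submatrix (reflect k) (Equiv.refl _) =
      diagonal fun j => u j * paleyDivisor R p h t j := by
    ext i j
    rw [submatrix_apply, hY, Equiv.refl_apply, diagonal_apply, ← hu2]
    by_cases hj : (j : ℕ) = 0
    · simp only [hj, pow_zero, mul_one, hT.sum_sub_pow hFk hk, mul_zero, Finset.sum_const_zero]
      split_ifs with hij h0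
      · rfl
      · exact absurd (hij ▸ hj) h0
      · rfl
    · rw [hT.sum_sum_mul hFk hk hke]
      simp only [val_reflect_eq_iff hk i j hj]
      split_ifs with hij h0
      · exact absurd (hij ▸ h0) hj
      · rw [hij]
      · rfl
  have h3 := smithEquiv_submatrix_perm Y (reflect k) (Equiv.refl _)
  rw [h2] at h3
  exact (h1.trans h3).trans (smithEquiv_diagonal_unit_mul hu1)

end IsTeichmuller

end

end PaleySmith

/-! ### The Laplacian -/

namespace PaleySmith

open Matrix

section Laplacian

variable {R F : Type*} [CommRing R] [IsDomain R] [Field F]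
  {p k : ℕ} {π : R →+* F} {T : F →* R}

namespace IsTeichmuller

lemma map_neg_one (hT : IsTeichmuller p π T) (hF : ringChar F ≠ 2) : T (-1) = -1 := by
  have h1 : T (-1) * T (-1) = 1 := by rw [← map_mul]; simp
  rcases mul_self_eq_one_iff.1 h1 with h | h
  · rw [← map_one T] at h
    exact absurd (hT.injective h) (Ring.neg_one_ne_one_of_char_ne_two hF)
  · exact h

variable [Fintype F]

lemma pow_eq_ite_isSquare [DecidablePred (IsSquare : F → Prop)] (hT : IsTeichmuller p π T)
    (hF : ringChar F ≠ 2) (hk : Fintype.card F = 2 * k + 1) {x : F} (hx : x ≠ 0) :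
    T x ^ k = if IsSquare x then 1 else -1 := by
  have hk' : Fintype.card F / 2 = k := by omega
  have hiff := FiniteField.isSquare_iff hF hx
  rw [hk'] at hiff
  rw [← map_pow]
  split_ifs with h
  · rw [hiff.1 h, map_one]
  · have := FiniteField.pow_dichotomy hF hx
    rw [hk', ← hiff] at this
    rw [this.resolve_left h, hT.map_neg_one hF]

lemma paleyMatrix_mul_ones (hT : IsTeichmuller p π T) (hF : Fintype.card F = 2 * k + 1)
    (hk : 0 < k) : paleyMatrix T k * (of fun _ _ => 1 : Matrix F F R) = 0 := by
  ext x y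
  simp [paleyMatrix, mul_apply, hT.sum_sub_pow hF hk]

variable [DecidableEq F]

lemma paleyMatrix_mul_self (hT : IsTeichmuller p π T) (hF : Fintype.card F = 2 * k + 1)
    (hk : 0 < k) (hke : Even k) :
    paleyMatrix T k * paleyMatrix T k = (2 * k + 1 : R) • 1 - of fun _ _ => 1 := by
  ext x y
  simp only [paleyMatrix, mul_apply, of_apply, hT.sum_autocorrelation hF hk hke, Matrix.sub_apply,
    Matrix.smul_apply, one_apply, smul_eq_mul]
  split_ifs <;> ring

lemma smithEquiv_laplacian [DecidablePred (IsSquare : F → Prop)] (hT : IsTeichmuller p π T)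
    (hF2 : ringChar F ≠ 2) (hF : Fintype.card F = 2 * k + 1) (hk : 0 < k) (hke : Even k)
    {L : Matrix F F R}
    (hL : ∀ x y, L x y = (if x = y then (k : R) else 0) -
      if x ≠ y ∧ IsSquare (x - y) then 1 else 0) :
    SmithEquiv (paleyMatrix T k) L := by
  obtain ⟨c, hc⟩ : ∃ c : R, 2 * c = 1 := by
    refine (hT.isUnit 2 ?_).exists_right_inv
    rw [map_ofNat]
    exact Ring.two_ne_zero hF2
  obtain ⟨α, hα⟩ : ∃ α : R, -(2 * k) * α = 1 := (hT.isUnit_two_mul hF).neg.exists_right_inv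
  have h1 := hT.paleyMatrix_mul_self hF hk hke
  have h2 : paleyMatrix T k * (paleyMatrix T k * paleyMatrix T k) =
      (2 * k + 1 : R) • paleyMatrix T k := by
    rw [h1, mul_sub, hT.paleyMatrix_mul_ones hF hk, sub_zero, mul_smul_comm, mul_one]
  have h3 : (2 : R) • L = paleyMatrix T k * paleyMatrix T k - paleyMatrix T k := by
    rw [h1]
    ext x y
    simp only [Matrix.sub_apply, Matrix.smul_apply, one_apply, of_apply, hL, paleyMatrix, smul_eq_mul]
    by_cases hxy : x = y
    · simp [hxy, hT.map_zero, hk.ne']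
    · rw [hT.pow_eq_ite_isSquare hF2 hF (sub_ne_zero.2 hxy)]
      simp only [hxy, if_false, ne_eq, not_false_eq_true, true_and]
      split_ifs <;> ring
  generalize paleyMatrix T k = X at *
  have h4 : L = X * (c • (X - 1)) := by
    rw [mul_smul_comm, mul_sub, mul_one, ← h3, smul_smul, mul_comm c, hc, one_smul]
  have h5 : (c • (X - 1)) * ((-2 : R) • (1 + α • X + α • (X * X))) = 1 := by
    have h6 : (c • (X - 1)) * ((-2 : R) • (1 + α • X + α • (X * X))) =
        (c * -2) • (-1 + (1 - α) • X + α • (X * (X * X))) := by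
      rw [smul_mul_smul_comm]
      congr 1
      simp only [sub_mul, mul_add, mul_smul_comm, one_mul, mul_one]
      module
    have h7 : (1 - α) + α * (2 * k + 1) = 0 := by linear_combination -hα
    rw [h6, h2, smul_smul, add_assoc, ← add_smul, h7, zero_smul, add_zero, smul_neg, ← neg_smul,
      show -(c * -2) = 1 by linear_combination hc, one_smul]
  rw [h4]
  exact SmithEquiv.mul_right X (.of_mul_eq_one _ h5)

end IsTeichmuller

end Laplacian

section Witt

variable {p : ℕ} [hp : Fact p.Prime] {F : Type*} [Field F] [Finite F] [CharP F p]

lemma isTeichmuller_witt :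
    IsTeichmuller p (WittVector.constantCoeff : WittVector p F →+* F)
      (WittVector.teichmuller p) := by
  have hunit : ∀ x : WittVector p F, x.coeff 0 ≠ 0 → IsUnit x :=
    WittVector.isUnit_of_coeff_zero_ne_zero
  refine ⟨WittVector.teichmuller_zero p, WittVector.teichmuller_coeff_zero p, fun x => ?_, hunit,
    (WittVector.irreducible p).prime⟩
  change x.coeff 0 = 0 ↔ _
  constructor
  · intro hx
    by_cases hx0 : x = 0
    · simp [hx0]
    · obtain ⟨m, b, hb, rfl⟩ := WittVector.exists_eq_pow_p_mul x hx0
      rcases m with _ | m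
      · rw [pow_zero, one_mul] at hx; exact absurd hx hb
      · exact ⟨_, by rw [pow_succ', mul_assoc]⟩
  · rintro ⟨y, rfl⟩
    rw [mul_comm, WittVector.mul_charP_coeff_zero]

/-- The inclusion of the `p`-adic integers into the Witt vectors of an extension of `𝔽_p`. -/
noncomputable def padicToWitt (p : ℕ) [Fact p.Prime] (F : Type*) [Field F] [CharP F p] :
    ℤ_[p] →+* WittVector p F :=
  (WittVector.map (ZMod.castHom (dvd_refl p) F)).comp (WittVector.equiv p).symm.toRingHom

lemma exists_smithEquiv_diagonal_pow {F : Type*} [Fintype F] [DecidableEq F]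
    (L : Matrix F F ℤ_[p]) :
    ∃ d : F → ℤ_[p], SmithEquiv L (diagonal d) ∧
      ∀ x, d x = 0 ∨ ∃ m : ℕ, d x = (p : ℤ_[p]) ^ m := by
  classical
  let e := Fintype.equivFin F
  obtain ⟨d, hd⟩ := exists_smithEquiv_diagonal _ (L.submatrix e.symm e.symm)
  have h1 := hd.submatrix e
  rw [submatrix_diagonal_equiv, submatrix_submatrix, e.symm_comp_self, submatrix_id_id] at h1
  have h2 : ∀ x, ∃ u w : ℤ_[p], IsUnit u ∧ (d ∘ e) x = u * w ∧
      (w = 0 ∨ ∃ m : ℕ, w = (p : ℤ_[p]) ^ m) := by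
    intro x
    by_cases hx : (d ∘ e) x = 0
    · exact ⟨1, 0, isUnit_one, by rw [hx, mul_zero], .inl rfl⟩
    · exact ⟨_, _, Units.isUnit _, PadicInt.unitCoeff_spec hx, .inr ⟨_, rfl⟩⟩
  choose u w hu hw hw' using h2
  rw [show d ∘ e = fun x => u x * w x from funext hw] at h1
  exact ⟨w, h1.trans (smithEquiv_diagonal_unit_mul hu), hw'⟩

lemma padicToWitt_dvd_iff (l : ℕ) {d : ℤ_[p]}
    (hd : d = 0 ∨ ∃ m : ℕ, d = (p : ℤ_[p]) ^ m) :
    d = (p : ℤ_[p]) ^ l ↔ (p : WittVector p F) ^ l ∣ padicToWitt p F d ∧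
      ¬ (p : WittVector p F) ^ (l + 1) ∣ padicToWitt p F d := by
  have hW : Prime (p : WittVector p F) := isTeichmuller_witt.prime
  have hZ : Prime (p : ℤ_[p]) := PadicInt.prime_p
  rcases hd with rfl | ⟨m, rfl⟩
  · simp [eq_comm, hp.out.ne_zero]
  · rw [map_pow, map_natCast, pow_dvd_pow_iff hW.ne_zero hW.not_isUnit,
      pow_dvd_pow_iff hW.ne_zero hW.not_isUnit,
      (pow_injective_of_not_isUnit hZ.not_isUnit hZ.ne_zero).eq_iff]
    omega

end Witt

theorem card_eq_carryCount {p h t : ℕ} [hp : Fact p.Prime] (ht : 1 ≤ t) (hph : p = 2 * h + 1)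
    (hh : 0 < h) (hke : Even (repdigit p h t)) {F : Type*} [Field F] [Fintype F] [DecidableEq F]
    [DecidablePred (IsSquare : F → Prop)] (hcard : Fintype.card F = p ^ t) {L : Matrix F F ℤ_[p]}
    (hL : ∀ x y : F, L x y = (if x = y then (repdigit p h t : ℤ_[p]) else 0) -
      if x ≠ y ∧ IsSquare (x - y) then 1 else 0) {d : F → ℤ_[p]} (hLd : SmithEquiv L (diagonal d))
    (hd : ∀ x, d x = 0 ∨ ∃ m : ℕ, d x = (p : ℤ_[p]) ^ m) (l : ℕ) :
    Nat.card {x : F // d x = (p : ℤ_[p]) ^ l} = carryCount p h t l := by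
  have hchar : CharP F p := charP_of_card_eq_prime_pow hcard
  have hF2 : ringChar F ≠ 2 := by rw [ringChar.eq F p]; omega
  have hT := isTeichmuller_witt (p := p) (F := F)
  have hq := two_mul_repdigit hph t
  have hk : 0 < repdigit p h t := by
    have := Nat.one_lt_pow (n := t) (by omega) hp.out.one_lt
    omega
  let e : Fin (2 * repdigit p h t + 1) ≃ F := Fintype.equivOfCardEq (by simp [hcard, hq])
  let ι := padicToWitt p F
  have h1 : SmithEquiv (paleyMatrix (WittVector.teichmuller p : F →* _) (repdigit p h t))
      (L.map ι) :=
    hT.smithEquiv_laplacian hF2 (by omega) hk hke fun x y => by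
      rw [map_apply, hL, map_sub, apply_ite ι, apply_ite ι, map_natCast, map_zero, map_one]
  have h2 := (h1.trans (hLd.map ι)).submatrix e
  rw [diagonal_map (map_zero ι), submatrix_diagonal_equiv] at h2
  have h3 := (hT.smithEquiv_paleyMatrix hcard (by omega) hp.out hph hh hk hke e).symm.trans h2
  have h4 := h3.card_dvd_eq (WittVector.constantCoeff_surjective p) hT.ker hT.prime
  rw [← card_paleyDivisor (R := WittVector p F) (t := t) (N := 2 * repdigit p h t + 1) hT.prime rfl]
  have h5 := card_exact_eq (p : WittVector p F)
    (fun j : Fin (2 * repdigit p h t + 1) => paleyDivisor (WittVector p F) p h t j) l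
  have h6 := card_exact_eq (p : WittVector p F) ((fun x => ι (d x)) ∘ e) l
  rw [h4 l, h4 (l + 1), ← h6] at h5
  rw [Nat.add_right_cancel h5]
  refine Nat.card_congr (e.subtypeEquiv fun j => ?_).symm
  exact (padicToWitt_dvd_iff l (hd (e j))).symm

end PaleySmith

/-- For `q = p^t ≡ 1 (mod 4)`, the Laplacian of the Paley graph `P(q)` has a
Smith normal form over `ℤ_p` in which, for `0 ≤ λ < t`, the number of diagonal
entries equal to `p^λ` is
`f(t,λ) = Σ_{i=0}^{min(λ,t−λ)} (t/(t−i))·C(t−i,i)·C(t−2i,λ−i)·(−p)^i·((p+1)/2)^{t−2i}`,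
and the number of diagonal entries equal to `p^t` is `((p+1)/2)^t − 2`. -/
theorem paley_laplacian_elementary_divisors
    (p t q : ℕ) [hp : Fact p.Prime] (ht : 1 ≤ t) (hq : q = p ^ t) (hq4 : q % 4 = 1)
    (F : Type*) [Field F] [Fintype F] [DecidableEq F]
    [DecidablePred (IsSquare : F → Prop)]
    (hcard : Fintype.card F = q)
    (L : Matrix F F ℤ_[p])
    (hL : ∀ x y : F, L x y =
      (if x = y then (((q - 1) / 2 : ℕ) : ℤ_[p]) else 0) -
        (if x ≠ y ∧ IsSquare (x - y) then 1 else 0)) :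
    ∃ (P Q : Matrix F F ℤ_[p]) (d : F → ℤ_[p]),
      IsUnit P.det ∧ IsUnit Q.det ∧ P * L * Q = Matrix.diagonal d ∧
      (∀ l : ℕ, l < t →
        ((Nat.card {x : F // d x = (p : ℤ_[p]) ^ l} : ℚ) =
          ∑ i ∈ Finset.range (min l (t - l) + 1),
            (t : ℚ) / ((t : ℚ) - (i : ℚ)) * ((t - i).choose i : ℚ) *
              ((t - 2 * i).choose (l - i) : ℚ) * (-(p : ℚ)) ^ i *
              ((((p + 1) / 2 : ℕ) : ℚ)) ^ (t - 2 * i))) ∧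
      Nat.card {x : F // d x = (p : ℤ_[p]) ^ t} = ((p + 1) / 2) ^ t - 2 := by
  subst hq
  have hp2 : p ≠ 2 := by
    rintro rfl
    obtain ⟨s, rfl⟩ := Nat.exists_eq_add_of_le' ht
    omega
  obtain ⟨h, hph⟩ := hp.out.odd_of_ne_two hp2
  have hh : 0 < h := by have := hp.out.one_lt; omega
  have hq := PaleySmith.two_mul_repdigit hph t
  have hk : PaleySmith.repdigit p h t = (p ^ t - 1) / 2 := by omega
  have hke : Even (PaleySmith.repdigit p h t) := by rw [Nat.even_iff]; omega
  have hk0 : 0 < PaleySmith.repdigit p h t := by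
    have := Nat.one_lt_pow (n := t) (by omega) hp.out.one_lt
    omega
  rw [← hk] at hL
  obtain ⟨d, ⟨P, Q, hP, hQ, hPQ⟩, hd⟩ := PaleySmith.exists_smithEquiv_diagonal_pow L
  have hcount := PaleySmith.card_eq_carryCount ht hph hh hke hcard hL ⟨P, Q, hP, hQ, hPQ⟩ hd
  rw [Matrix.isUnit_iff_isUnit_det] at hP hQ
  have hph' : (p + 1) / 2 = h + 1 := by omega
  refine ⟨P, Q, d, hP, hQ, hPQ, fun l hl => ?_, ?_⟩
  · rw [hcount, hph', ← PaleySmith.carryCount_add hph hh ht hk0 hl.le, if_neg hl.ne, add_zero]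
  · rw [hcount, hph', PaleySmith.carryCount_top hph hh ht hk0]
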